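/- arXiv:1604.07718 — 2 statements merged into one kernel-verified Lean document; each statement's English description precedes it below -/
import Mathlib

section
/- Let m, ρ ∈ ℝ and define f(b) := Zbar(b) + m/q + ((q+r)/r)·ρ + ((r+q)/(r·φ))·Zqr(b) for b ≥ 0. Then f is strictly increasing on [0,∞) with f(b) → ∞ as b → ∞, and there exists a unique b > 0 with f(b) = 0 if and only if m < −(q/r)·(q+r)·(ρ + 1/φ). -/
open MeasureTheory Real Set Filter Topology

/-- `Wbar x = ∫_0^x W(z) dz`. -/
noncomputable def Wbar (W : ℝ → ℝ) (x : ℝ) : ℝ := ∫ z in (0:ℝ)..x, W z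

/-- `Zq x = 1 + q · Wbar x`. -/
noncomputable def Zq (q : ℝ) (W : ℝ → ℝ) (x : ℝ) : ℝ := 1 + q * Wbar W x

/-- `Zbar x = ∫_0^x Zq(z) dz`. -/
noncomputable def Zbar (q : ℝ) (W : ℝ → ℝ) (x : ℝ) : ℝ := ∫ z in (0:ℝ)..x, Zq q W z

/-- `J x = e^{φx} (1 − r ∫_0^x e^{−φz} W(z) dz)`. -/
noncomputable def Jfun (r φ : ℝ) (W : ℝ → ℝ) (x : ℝ) : ℝ :=
  Real.exp (φ * x) * (1 - r * ∫ z in (0:ℝ)..x, Real.exp (-φ * z) * W z)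

/-- `Zqr x = (r/(r+q)) Zq x + (q/(r+q)) J x`. -/
noncomputable def Zqr (q r φ : ℝ) (W : ℝ → ℝ) (x : ℝ) : ℝ :=
  (r / (r + q)) * Zq q W x + (q / (r + q)) * Jfun r φ W x

theorem strictMonoOn_Ici_of_sub_le_sub {f : ℝ → ℝ}
    (h : ∀ x y, 0 ≤ x → x ≤ y → y - x ≤ f y - f x) : StrictMonoOn f (Set.Ici 0) := by
  intro x hx y _ hxy
  linarith [h x y hx hxy.le]

theorem tendsto_atTop_of_sub_le_sub {f : ℝ → ℝ}
    (h : ∀ x y, 0 ≤ x → x ≤ y → y - x ≤ f y - f x) : Tendsto f atTop atTop := by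
  refine tendsto_atTop_mono' atTop ?_ (tendsto_atTop_add_const_right atTop (f 0) tendsto_id)
  filter_upwards [eventually_ge_atTop 0] with x hx
  simp only [id]
  linarith [h 0 x le_rfl hx]

/-- A continuous function that is strictly increasing and unbounded on `[0, ∞)` has a unique
positive zero exactly when its value at `0` is negative. -/
theorem existsUnique_pos_zero_iff {f : ℝ → ℝ} (hc : Continuous f)
    (hmono : StrictMonoOn f (Set.Ici 0)) (htop : Tendsto f atTop atTop) :
    (∃! b : ℝ, 0 < b ∧ f b = 0) ↔ f 0 < 0 := by
  constructor
  · rintro ⟨b, ⟨hb, hfb⟩, -⟩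
    exact hfb ▸ hmono Set.self_mem_Ici hb.le hb
  · intro h0
    obtain ⟨c, hfc, hc0⟩ := ((htop.eventually_ge_atTop 0).and (eventually_ge_atTop 0)).exists
    obtain ⟨b, hb, hfb⟩ := intermediate_value_Icc hc0 hc.continuousOn ⟨h0.le, hfc⟩
    have hb0 : 0 < b := hb.1.lt_of_ne (by rintro rfl; exact h0.ne hfb)
    exact ⟨b, ⟨hb0, hfb⟩, fun y hy =>
      hmono.injOn hy.1.le hb0.le (hy.2.trans hfb.symm)⟩

section ScaleFunction

variable {q r φ : ℝ} {W : ℝ → ℝ}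

theorem integrable_exp_mul_of_integrableOn_Ioi (hWneg : ∀ x < (0 : ℝ), W x = 0)
    (hWint : IntegrableOn (fun z => Real.exp (-φ * z) * W z) (Set.Ioi 0)) :
    Integrable (fun z => Real.exp (-φ * z) * W z) := by
  have hneg : IntegrableOn (fun z => Real.exp (-φ * z) * W z) (Set.Iic 0) := by
    rw [integrableOn_Iic_iff_integrableOn_Iio]
    exact integrableOn_zero.congr_fun (fun x hx => by simp [hWneg x hx]) measurableSet_Iio
  rw [← integrableOn_univ, ← Set.Iic_union_Ioi (a := (0 : ℝ))]
  exact hneg.union hWint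

theorem intervalIntegrable_of_integrable_exp_mul
    (hg : Integrable (fun z => Real.exp (-φ * z) * W z)) (a b : ℝ) :
    IntervalIntegrable W volume a b := by
  have h := hg.intervalIntegrable (a := a) (b := b) |>.continuousOn_mul
    (g := fun z => Real.exp (φ * z)) (by fun_prop)
  refine h.congr fun z _ => ?_
  simp [← mul_assoc, ← Real.exp_add]

theorem continuous_Zq (hW : ∀ a b, IntervalIntegrable W volume a b) : Continuous (Zq q W) :=
  continuous_const.add (continuous_const.mul (intervalIntegral.continuous_primitive hW 0))

theorem continuous_Zbar (hW : ∀ a b, IntervalIntegrable W volume a b) : Continuous (Zbar q W) :=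
  intervalIntegral.continuous_primitive
    (fun _ _ => (continuous_Zq hW).intervalIntegrable _ _) 0

theorem continuous_Jfun (hg : Integrable (fun z => Real.exp (-φ * z) * W z)) :
    Continuous (Jfun r φ W) :=
  Continuous.mul (by fun_prop) (continuous_const.sub (continuous_const.mul
    (intervalIntegral.continuous_primitive (fun _ _ => hg.intervalIntegrable) 0)))

theorem Zq_mono (hq : 0 ≤ q) (hWnn : ∀ x, 0 ≤ W x)
    (hW : ∀ a b, IntervalIntegrable W volume a b) : Monotone (Zq q W) := by
  intro x y hxy
  have h : Wbar W y - Wbar W x = ∫ z in x..y, W z :=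
    intervalIntegral.integral_interval_sub_left (hW 0 y) (hW 0 x)
  have h' : 0 ≤ ∫ z in x..y, W z := intervalIntegral.integral_nonneg hxy fun z _ => hWnn z
  have : Wbar W x ≤ Wbar W y := by linarith
  simp only [Zq]
  gcongr

theorem sub_le_Zbar_sub (hq : 0 ≤ q) (hWnn : ∀ x, 0 ≤ W x)
    (hW : ∀ a b, IntervalIntegrable W volume a b) {x y : ℝ} (hx : 0 ≤ x) (hxy : x ≤ y) :
    y - x ≤ Zbar q W y - Zbar q W x := by
  have hZ : ∀ a b, IntervalIntegrable (Zq q W) volume a b :=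
    fun _ _ => (continuous_Zq hW).intervalIntegrable _ _
  have h : Zbar q W y - Zbar q W x = ∫ z in x..y, Zq q W z :=
    intervalIntegral.integral_interval_sub_left (hZ 0 y) (hZ 0 x)
  rw [h]
  calc y - x = ∫ _ in x..y, (1 : ℝ) := by simp
    _ ≤ ∫ z in x..y, Zq q W z := by
      refine intervalIntegral.integral_mono_on hxy (by simp) (hZ x y) fun z hz => ?_
      simpa [Zq, Wbar] using Zq_mono hq hWnn hW (hx.trans hz.1)

/-- Under the normalisation `r ∫_0^∞ e^{-φz} W(z) dz = 1`, the function `J` is the Laplace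
transform of a shift of `W`. -/
theorem Jfun_eq_integral_shift (hg : Integrable (fun z => Real.exp (-φ * z) * W z))
    (hWlap : r * ∫ z in Set.Ioi (0 : ℝ), Real.exp (-φ * z) * W z = 1) (x : ℝ) :
    Jfun r φ W x = r * ∫ u in Set.Ioi (0 : ℝ), Real.exp (-φ * u) * W (u + x) := by
  have hsplit := intervalIntegral.integral_interval_add_Ioi (a := 0) (b := x)
    hg.integrableOn hg.integrableOn
  have hshift : ∫ u in Set.Ioi (0 : ℝ), Real.exp (-φ * (u + x)) * W (u + x) =
      ∫ z in Set.Ioi x, Real.exp (-φ * z) * W z := by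
    have h := (measurePreserving_add_right volume x).setIntegral_preimage_emb
      (measurableEmbedding_addRight x) (fun z => Real.exp (-φ * z) * W z) (Set.Ioi x)
    simpa using h
  rw [Jfun, ← hWlap, ← hsplit, ← hshift, ← mul_sub, add_sub_cancel_left, mul_left_comm,
    ← integral_const_mul]
  congr 2
  ext u
  rw [← mul_assoc, ← Real.exp_add]
  ring_nf

theorem integrable_exp_mul_shift (hg : Integrable (fun z => Real.exp (-φ * z) * W z)) (x : ℝ) :
    Integrable (fun u => Real.exp (-φ * u) * W (u + x)) := by
  refine ((hg.comp_add_right x).const_mul (Real.exp (φ * x))).congr (ae_of_all _ fun u => ?_)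
  simp only [← mul_assoc, ← Real.exp_add]
  ring_nf

theorem Jfun_monotoneOn (hr : 0 ≤ r) (hWmono : StrictMonoOn W (Set.Ioi 0))
    (hg : Integrable (fun z => Real.exp (-φ * z) * W z))
    (hWlap : r * ∫ z in Set.Ioi (0 : ℝ), Real.exp (-φ * z) * W z = 1) :
    MonotoneOn (Jfun r φ W) (Set.Ici 0) := by
  intro x hx y hy hxy
  rw [Jfun_eq_integral_shift hg hWlap, Jfun_eq_integral_shift hg hWlap]
  refine mul_le_mul_of_nonneg_left (setIntegral_mono_on
    (integrable_exp_mul_shift hg x).integrableOn (integrable_exp_mul_shift hg y).integrableOn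
    measurableSet_Ioi fun u hu => ?_) hr
  refine mul_le_mul_of_nonneg_left (hWmono.monotoneOn ?_ ?_ (by linarith)) (Real.exp_pos _).le
  · exact add_pos_of_pos_of_nonneg (Set.mem_Ioi.1 hu) (Set.mem_Ici.1 hx)
  · exact add_pos_of_pos_of_nonneg (Set.mem_Ioi.1 hu) (Set.mem_Ici.1 hy)

end ScaleFunction

/-- with f(b) = Zbar(b) + m/q + ((q+r)/r)ρ + ((r+q)/(rφ))·Zqr(b), the function f is
strictly increasing on [0,∞), tends to ∞, and has a unique root b > 0 iff
m < −(q/r)(q+r)(ρ + 1/φ). -/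
theorem exists_unique_root_iff
    (q r φ : ℝ) (W : ℝ → ℝ)
    (hq : 0 < q) (hr : 0 < r) (hφ : 0 < φ)
    (hWneg : ∀ x < (0:ℝ), W x = 0)
    (hWnn : ∀ x : ℝ, 0 ≤ W x)
    (hWcont : ContinuousOn W (Set.Ioi 0))
    (hWmono : StrictMonoOn W (Set.Ioi 0))
    (W0 : ℝ)
    (hW0 : Filter.Tendsto W (nhdsWithin 0 (Set.Ioi 0)) (nhds W0))
    (hWint : MeasureTheory.IntegrableOn (fun z => Real.exp (-φ * z) * W z) (Set.Ioi 0))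
    (hWlap : r * ∫ z in Set.Ioi (0:ℝ), Real.exp (-φ * z) * W z = 1)
    (m ρ : ℝ) (f : ℝ → ℝ)
    (hf : ∀ b : ℝ, f b = Zbar q W b + m / q + (q + r) / r * ρ + (r + q) / (r * φ) * Zqr q r φ W b)
    : StrictMonoOn f (Set.Ici 0) ∧ Filter.Tendsto f Filter.atTop Filter.atTop ∧
      ((∃! b : ℝ, 0 < b ∧ f b = 0) ↔ m < -(q / r) * (q + r) * (ρ + 1 / φ)) := by
  have hg := integrable_exp_mul_of_integrableOn_Ioi hWneg hWint
  have hW := intervalIntegrable_of_integrable_exp_mul hg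
  have hcont : Continuous f := by
    have hZbar := continuous_Zbar (q := q) hW
    have hZq := continuous_Zq (q := q) hW
    have hJ := continuous_Jfun (r := r) hg
    rw [funext hf]
    unfold Zqr
    fun_prop
  have hgrowth : ∀ x y, 0 ≤ x → x ≤ y → y - x ≤ f y - f x := by
    intro x y hx hxy
    have hZbar := sub_le_Zbar_sub hq.le hWnn hW hx hxy
    have hZq := Zq_mono hq.le hWnn hW hxy
    have hJ := Jfun_monotoneOn hr.le hWmono hg hWlap hx (hx.trans hxy) hxy
    have hZqr : (r + q) / (r * φ) * Zqr q r φ W x ≤ (r + q) / (r * φ) * Zqr q r φ W y := by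
      unfold Zqr
      gcongr
    rw [hf, hf]
    linarith
  have hmono := strictMonoOn_Ici_of_sub_le_sub hgrowth
  have htop := tendsto_atTop_of_sub_le_sub hgrowth
  refine ⟨hmono, htop, (existsUnique_pos_zero_iff hcont hmono htop).trans ?_⟩
  have hzero : f 0 = (m - -(q / r) * (q + r) * (ρ + 1 / φ)) / q := by
    rw [hf]
    simp only [Zbar, Zqr, Zq, Wbar, Jfun, intervalIntegral.integral_same, mul_zero, Real.exp_zero]
    field_simp
    ring
  rw [hzero, div_lt_iff₀ hq, zero_mul, sub_neg]
end

section
/- Assume ∫_{[1,∞)} z Π(dz) < ∞, set m := γ − ∫_{[1,∞)} z Π(dz), let q, r > 0, let φ > 0 satisfy ψ(φ) = q + r, and fix ρ ∈ ℝ. Define v_0(x) := (r/(r+q))·[ x − (m/(r+q) − ρ) + (m/(r+q) + qρ/r)·e^{−φx} ] for x ∈ ℝ. Then for every x ∈ ℝ the integral in (ℒv_0)(x) converges absolutely and (ℒ − q)v_0(x) = (r/(r+q))·[ −( r·m/(r+q) + q·ρ )·(1 − e^{−φx}) − q·x ]. -/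
open MeasureTheory Real Set Filter Topology

/-- The Laplace exponent ψ(θ) = γθ + (σ²/2)θ² + ∫_{(0,∞)} (e^{−θz} − 1 + θz·1_{0<z<1}) ν(dz)
of a spectrally positive Lévy process. -/
noncomputable def levyPsi (γ σ : ℝ) (ν : MeasureTheory.Measure ℝ) (θ : ℝ) : ℝ :=
  γ * θ + σ ^ 2 / 2 * θ ^ 2 +
    ∫ z in Set.Ioi (0:ℝ),
      (Real.exp (-θ * z) - 1 + θ * Set.indicator (Set.Ioo (0:ℝ) 1) id z) ∂ν

/-- The generator (ℒg)(x) = −γg′(x) + (σ²/2)g″(x)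
+ ∫_{(0,∞)} (g(x+z) − g(x) − g′(x)·z·1_{0<z<1}) ν(dz). -/
noncomputable def levyGen (γ σ : ℝ) (ν : MeasureTheory.Measure ℝ) (g : ℝ → ℝ) (x : ℝ) : ℝ :=
  -γ * deriv g x + σ ^ 2 / 2 * deriv (deriv g) x +
    ∫ z in Set.Ioi (0:ℝ),
      (g (x + z) - g x - deriv g x * Set.indicator (Set.Ioo (0:ℝ) 1) id z) ∂ν

theorem abs_exp_neg_sub_one_add_le_sq {u : ℝ} (hu : 0 ≤ u) :
    |exp (-u) - 1 + u| ≤ u ^ 2 := by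
  have hlower := add_one_le_exp (-u)
  have hupper : exp (-u) ≤ 1 - u + u ^ 2 := by
    rw [exp_neg, inv_le_iff_one_le_mul₀ (exp_pos u)]
    calc (1 : ℝ) ≤ (1 - u + u ^ 2) * (u + 1) := by nlinarith [pow_nonneg hu 3]
      _ ≤ (1 - u + u ^ 2) * exp u := by
        gcongr
        · nlinarith [sq_nonneg (u - 1)]
        · exact add_one_le_exp u
  rw [abs_le]
  constructor <;> nlinarith [sq_nonneg u]

/-- The integrand of the Laplace exponent is integrable against a Lévy measure. -/
theorem integrableOn_levyPsi_integrand {ν : Measure ℝ}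
    (hν : IntegrableOn (fun z => min 1 (z ^ 2)) (Ioi 0) ν) {θ : ℝ} (hθ : 0 ≤ θ) :
    IntegrableOn (fun z => exp (-θ * z) - 1 + θ * indicator (Ioo (0 : ℝ) 1) id z) (Ioi 0) ν := by
  refine (hν.const_mul (1 + θ ^ 2)).mono' ?_ ?_
  · exact (((by fun_prop : Measurable fun z : ℝ => exp (-θ * z) - 1)).add
      ((measurable_id.indicator measurableSet_Ioo).const_mul θ)).aestronglyMeasurable
  · filter_upwards [ae_restrict_mem measurableSet_Ioi] with z hz
    have hz0 : 0 < z := hz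
    have hu : 0 ≤ θ * z := by positivity
    rw [Real.norm_eq_abs]
    rcases lt_or_ge z 1 with h1 | h1
    · rw [indicator_of_mem (show z ∈ Ioo (0 : ℝ) 1 from ⟨hz0, h1⟩), id,
        min_eq_right (by nlinarith), neg_mul]
      nlinarith [abs_exp_neg_sub_one_add_le_sq hu, sq_nonneg z]
    · rw [indicator_of_notMem (fun h => absurd h.2 (not_lt.2 h1)), min_eq_left (by nlinarith),
        neg_mul, abs_le]
      have hpos := exp_pos (-(θ * z))
      have hle : exp (-(θ * z)) ≤ 1 := exp_le_one_iff.2 (by linarith)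
      constructor <;> nlinarith [sq_nonneg θ]

theorem hasDerivAt_affine_add_exp (a c K θ x : ℝ) :
    HasDerivAt (fun y => a * (y - c + K * exp (-θ * y))) (a * (1 - θ * K * exp (-θ * x))) x := by
  have hlin : HasDerivAt (fun y : ℝ => -θ * y) (-θ) x := by
    simpa using (hasDerivAt_id x).const_mul (-θ)
  exact ((((hasDerivAt_id' x).sub_const c).add (hlin.exp.const_mul K)).const_mul a).congr_deriv
    (by ring)

theorem hasDerivAt_deriv_affine_add_exp (a K θ x : ℝ) :
    HasDerivAt (fun y => a * (1 - θ * K * exp (-θ * y))) (a * (θ ^ 2 * K * exp (-θ * x))) x := by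
  have hlin : HasDerivAt (fun y : ℝ => -θ * y) (-θ) x := by
    simpa using (hasDerivAt_id x).const_mul (-θ)
  exact (((hlin.exp.const_mul (θ * K)).const_sub 1).const_mul a).congr_deriv (by ring)

/-- The generator maps `a (y - c + K exp (-θ y))` to
`a (-(γ - ∫_{[1,∞)} z ν(dz)) + K ψ(θ) exp (-θ y))`, its integral converging absolutely. -/
theorem levyGen_affine_add_exp (γ σ : ℝ) {ν : Measure ℝ}
    (hν : IntegrableOn (fun z => min 1 (z ^ 2)) (Ioi 0) ν)
    (hν1 : IntegrableOn (fun z => z) (Ici 1) ν) {θ : ℝ} (hθ : 0 ≤ θ) (a c K x : ℝ)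
    {g : ℝ → ℝ} (hg : g = fun y => a * (y - c + K * exp (-θ * y))) :
    IntegrableOn (fun z => g (x + z) - g x - deriv g x * indicator (Ioo (0 : ℝ) 1) id z)
        (Ioi 0) ν ∧
      levyGen γ σ ν g x =
        a * (-(γ - ∫ z in Ici (1 : ℝ), z ∂ν) + K * levyPsi γ σ ν θ * exp (-θ * x)) := by
  have hderiv : deriv g = fun y => a * (1 - θ * K * exp (-θ * y)) := by
    rw [hg]
    exact funext fun y => (hasDerivAt_affine_add_exp a c K θ y).deriv
  have hderiv2 : deriv (deriv g) x = a * (θ ^ 2 * K * exp (-θ * x)) := by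
    rw [hderiv]
    exact (hasDerivAt_deriv_affine_add_exp a K θ x).deriv
  have hinter : Ici (1 : ℝ) ∩ Ioi 0 = Ici 1 :=
    inter_eq_left.2 (Ici_subset_Ioi.2 one_pos)
  have hjump : IntegrableOn (indicator (Ici (1 : ℝ)) fun z => z) (Ioi 0) ν := by
    rw [IntegrableOn, integrable_indicator_iff measurableSet_Ici, IntegrableOn,
      Measure.restrict_restrict measurableSet_Ici, hinter]
    exact hν1
  have hjump_integral : ∫ z in Ioi (0 : ℝ), indicator (Ici (1 : ℝ)) (fun z => z) z ∂ν =
      ∫ z in Ici (1 : ℝ), z ∂ν := by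
    rw [integral_indicator measurableSet_Ici, Measure.restrict_restrict measurableSet_Ici, hinter]
  have hpsi := integrableOn_levyPsi_integrand hν hθ
  have hdecomp : EqOn (fun z => g (x + z) - g x - deriv g x * indicator (Ioo (0 : ℝ) 1) id z)
      (fun z => a * indicator (Ici (1 : ℝ)) (fun z => z) z + a * K * exp (-θ * x) *
        (exp (-θ * z) - 1 + θ * indicator (Ioo (0 : ℝ) 1) id z)) (Ioi 0) := by
    intro z hz
    have hsplit : z = indicator (Ici (1 : ℝ)) (fun z => z) z + indicator (Ioo (0 : ℝ) 1) id z := by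
      rcases lt_or_ge z 1 with h1 | h1
      · rw [indicator_of_notMem (show z ∉ Ici (1 : ℝ) from not_le.2 h1),
          indicator_of_mem (show z ∈ Ioo (0 : ℝ) 1 from ⟨hz, h1⟩), id, zero_add]
      · rw [indicator_of_mem (show z ∈ Ici (1 : ℝ) from h1),
          indicator_of_notMem (fun h => absurd h.2 (not_lt.2 h1)), add_zero]
    simp only [hderiv]
    simp only [hg, mul_add (-θ) x z, exp_add]
    linear_combination a * hsplit
  refine ⟨?_, ?_⟩
  · exact (integrableOn_congr_fun hdecomp measurableSet_Ioi).2
      ((hjump.const_mul a).add (hpsi.const_mul _))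
  · rw [levyGen, hderiv2, setIntegral_congr_fun measurableSet_Ioi hdecomp,
      integral_add (hjump.const_mul a) (hpsi.const_mul _), integral_const_mul, integral_const_mul,
      hjump_integral, hderiv, levyPsi]
    ring

/-- with m = γ − ∫_{[1,∞)} z ν(dz), ψ(φ) = q + r, and
v₀(x) = (r/(r+q))·[x − (m/(r+q) − ρ) + (m/(r+q) + qρ/r)·e^{−φx}], the generator integral converges
absolutely at every x and (ℒ − q)v₀(x) = (r/(r+q))·[−(rm/(r+q) + qρ)(1 − e^{−φx}) − qx]. -/
theorem levyGen_v0
    (γ σ : ℝ) (hσ : 0 ≤ σ) (ν : MeasureTheory.Measure ℝ)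
    (hν : MeasureTheory.IntegrableOn (fun z => min 1 (z ^ 2)) (Set.Ioi 0) ν)
    (hν1 : MeasureTheory.IntegrableOn (fun z => z) (Set.Ici 1) ν)
    (m : ℝ) (hm : m = γ - ∫ z in Set.Ici (1:ℝ), z ∂ν)
    (q r φ ρ : ℝ) (hq : 0 < q) (hr : 0 < r) (hφ : 0 < φ)
    (hψ : levyPsi γ σ ν φ = q + r)
    (v₀ : ℝ → ℝ)
    (hv₀ : ∀ x : ℝ, v₀ x =
      r / (r + q) * (x - (m / (r + q) - ρ) + (m / (r + q) + q * ρ / r) * Real.exp (-φ * x)))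
    : ∀ x : ℝ,
        MeasureTheory.IntegrableOn
          (fun z => v₀ (x + z) - v₀ x - deriv v₀ x * Set.indicator (Set.Ioo (0:ℝ) 1) id z)
          (Set.Ioi 0) ν ∧
        levyGen γ σ ν v₀ x - q * v₀ x =
          r / (r + q) * (-(r * m / (r + q) + q * ρ) * (1 - Real.exp (-φ * x)) - q * x) := by
  intro x
  obtain ⟨hint, hgen⟩ := levyGen_affine_add_exp γ σ hν hν1 hφ.le (r / (r + q))
    (m / (r + q) - ρ) (m / (r + q) + q * ρ / r) x (funext hv₀)
  refine ⟨hint, ?_⟩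
  rw [hgen, ← hm, hψ, hv₀]
  have hrq : r + q ≠ 0 := by positivity
  field_simp
  ring
end
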